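/- Let d ≥ 2 be an integer, x ≥ 0, and r > 0. Then ∫_{S^{d−1}} ((x e₁ + r v)(x e₁ + r v)ᵀ) / (x² + r² + 2 r x ⟨v, e₁⟩) dσ(v) = (S_{d−1} − S_{d−2} J(x/r)) · e₁ e₁ᵀ + (S_{d−2}/(d−1)) · J(x/r) · (I_d − e₁ e₁ᵀ), where σ is the (d−1)-dimensional surface measure on the unit sphere S^{d−1} ⊂ ℝ^d, e₁ is the first standard basis vector, and J(u) = ∫₀^π sin^d(φ) / (1 + u² + 2u cos φ) dφ. -/

import Mathlib

noncomputable section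
open MeasureTheory Real Matrix
open scoped RealInnerProductSpace

/-- `E d` is the Euclidean space `ℝ^d`. -/
abbrev E (d : ℕ) : Type := EuclideanSpace ℝ (Fin d)

/-- `S_n = 2 π^{(n+1)/2} / Γ((n+1)/2)`, the surface area of the unit `n`-sphere. -/
def sphereArea (n : ℕ) : ℝ := 2 * Real.pi ^ (((n : ℝ) + 1)/2) / Real.Gamma (((n : ℝ) + 1)/2)

/-- `J(u) = ∫₀^π sin^d φ / (1 + u² + 2u cos φ) dφ`. -/
def Jfun (d : ℕ) (u : ℝ) : ℝ :=
  ∫ φ in (0:ℝ)..Real.pi, (Real.sin φ)^d / (1 + u^2 + 2*u*Real.cos φ)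

open scoped ENNReal Pointwise
open Measure Set Metric

section Polar

variable {V : Type*} [NormedAddCommGroup V] [NormedSpace ℝ V] [MeasurableSpace V] [BorelSpace V]
  [FiniteDimensional ℝ V] [Nontrivial V] (μ : Measure V) [μ.IsAddHaarMeasure]

/-- Integration in polar coordinates for the lower Lebesgue integral. -/
theorem lintegral_eq_lintegral_toSphere {f : V → ℝ≥0∞} (hf : Measurable f) :
    ∫⁻ x, f x ∂μ = ∫⁻ v, ∫⁻ s : Ioi (0 : ℝ), f (s.1 • v.1)
      ∂volumeIoiPow (Module.finrank ℝ V - 1) ∂μ.toSphere := by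
  have hm : Measurable fun p : sphere (0 : V) 1 × Ioi (0 : ℝ) ↦ f (p.2.1 • p.1.1) := by
    fun_prop
  rw [← lintegral_prod _ hm.aemeasurable,
    ← (μ.measurePreserving_homeomorphUnitSphereProd).lintegral_comp hm]
  have h (x : ({0}ᶜ : Set V)) :
      (homeomorphUnitSphereProd V x).2.1 • (homeomorphUnitSphereProd V x).1.1 = x.1 :=
    congrArg Subtype.val ((homeomorphUnitSphereProd V).symm_apply_apply x)
  simp only [h]
  rw [lintegral_subtype_comap (measurableSet_singleton _).compl, restrict_compl_singleton]

/-- The lower Lebesgue integral against `volumeIoiPow` as an integral over the half-line. -/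
theorem lintegral_volumeIoiPow (n : ℕ) {f : ℝ → ℝ≥0∞} (hf : Measurable f) :
    ∫⁻ s : Ioi (0 : ℝ), f s ∂volumeIoiPow n =
      ∫⁻ s in Ioi (0 : ℝ), ENNReal.ofReal (s ^ n) * f s := by
  rw [volumeIoiPow, lintegral_withDensity_eq_lintegral_mul _ (by fun_prop) (by fun_prop),
    ← lintegral_subtype_comap measurableSet_Ioi]
  rfl

/-- The lower Lebesgue integral of a radial function. -/
theorem lintegral_fun_norm {f : ℝ → ℝ≥0∞} (hf : Measurable f) :
    ∫⁻ x, f ‖x‖ ∂μ = μ.toSphere univ *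
      ∫⁻ s in Ioi (0 : ℝ), ENNReal.ofReal (s ^ (Module.finrank ℝ V - 1)) * f s := by
  rw [lintegral_eq_lintegral_toSphere μ (by fun_prop), ← lintegral_volumeIoiPow _ hf, mul_comm,
    ← lintegral_const]
  refine lintegral_congr fun v ↦ lintegral_congr fun s ↦ ?_
  rw [norm_smul, norm_eq_of_mem_sphere v, mul_one, Real.norm_of_nonneg s.2.out.le]

end Polar

/-- The isomorphism `ℝ^(n+1) ≃ ℝ × ℝ^n` splitting off the first coordinate preserves volume. -/
theorem lintegral_euclidean_succ {n : ℕ} {f : E (n + 1) → ℝ≥0∞} (hf : Measurable f) :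
    ∫⁻ z, f z = ∫⁻ y : ℝ, ∫⁻ w : E n, f (WithLp.toLp 2 (Fin.cons y w.ofLp)) := by
  have h1 := (PiLp.volume_preserving_toLp (Fin (n + 1))).lintegral_comp hf
  have h2 := (volume_preserving_piFinSuccAbove (fun _ : Fin (n + 1) ↦ ℝ) 0).symm.lintegral_comp
    (f := fun z ↦ f (WithLp.toLp 2 z)) (by fun_prop)
  have h3 := ((MeasurePreserving.id (volume : Measure ℝ)).prod
    (PiLp.volume_preserving_ofLp (Fin n))).lintegral_comp
      (f := fun p ↦ f (WithLp.toLp 2 ((MeasurableEquiv.piFinSuccAbove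
        (fun _ : Fin (n + 1) ↦ ℝ) 0).symm p))) (by fun_prop)
  rw [← h1, ← h2]
  refine h3.symm.trans ?_
  rw [lintegral_prod _ (by fun_prop)]
  refine lintegral_congr fun y ↦ lintegral_congr fun w ↦ ?_
  simp [MeasurableEquiv.piFinSuccAbove, Fin.insertNthEquiv]

theorem toSphere_euclidean_univ {n : ℕ} (hn : 1 ≤ n) :
    (volume : Measure (E n)).toSphere univ = ENNReal.ofReal (sphereArea (n - 1)) := by
  have : Nonempty (Fin n) := ⟨⟨0, hn⟩⟩
  have hn0 : (0 : ℝ) < n := by exact_mod_cast hn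
  rw [toSphere_apply_univ, EuclideanSpace.volume_ball, finrank_euclideanSpace, Fintype.card_fin,
    ENNReal.ofReal_one, one_pow, one_mul, ← ENNReal.ofReal_natCast, ← ENNReal.ofReal_mul hn0.le,
    sphereArea, Nat.cast_sub hn, Nat.cast_one, sub_add_cancel, Real.Gamma_add_one (by positivity),
    Real.sqrt_eq_rpow, ← Real.rpow_natCast, ← Real.rpow_mul Real.pi_nonneg]
  have := (Real.Gamma_pos_of_pos (half_pos hn0)).ne'
  congr 1
  rw [one_div_mul_eq_div]
  field_simp

theorem sphereArea_nonneg (n : ℕ) : 0 ≤ sphereArea n := by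
  have := Real.Gamma_pos_of_pos (s := ((n : ℝ) + 1) / 2) (by positivity)
  unfold sphereArea
  positivity

/-- Integration of a zonal function over the sphere `S^n ⊂ ℝ^(n+1)`. -/
theorem lintegral_toSphere_zonal {n : ℕ} (hn : 1 ≤ n) {g : ℝ → ℝ≥0∞} (hg : Measurable g) :
    ∫⁻ v : sphere (0 : E (n + 1)) 1, g (v.1 0) ∂(volume : Measure (E (n + 1))).toSphere =
      ENNReal.ofReal (sphereArea (n - 1)) *
        ∫⁻ φ in Ioo 0 π, ENNReal.ofReal (sin φ ^ (n - 1)) * g (cos φ) := by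
  have : Nonempty (Fin n) := ⟨⟨0, hn⟩⟩
  have hI : Measurable ((Iio (1 : ℝ)).indicator (1 : ℝ → ℝ≥0∞)) :=
    measurable_one.indicator measurableSet_Iio
  set h : ℝ → ℝ≥0∞ := (Iio (1 : ℝ)).indicator 1
  set c : ℝ≥0∞ := ∫⁻ s : Ioi (0 : ℝ), h s ∂volumeIoiPow n with hc
  have hc' : c = ENNReal.ofReal (1 / (n + 1)) := by
    have := volumeIoiPow_apply_Iio n ⟨1, mem_Ioi.2 one_pos⟩
    rw [one_pow] at this
    rw [← this, ← lintegral_indicator_one measurableSet_Iio]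
    rfl
  have hc0 : c ≠ 0 := by
    rw [hc', Ne, ENNReal.ofReal_eq_zero, not_le]
    positivity
  have hcT : c ≠ ∞ := hc' ▸ ENNReal.ofReal_ne_top
  set F : E (n + 1) → ℝ≥0∞ := fun z ↦ g (z 0 / ‖z‖) * h ‖z‖ with hF
  have hFm : Measurable F := by fun_prop
  have hL : ∫⁻ z, F z = (∫⁻ v : sphere (0 : E (n + 1)) 1, g (v.1 0)
      ∂(volume : Measure (E (n + 1))).toSphere) * c := by
    rw [lintegral_eq_lintegral_toSphere _ hFm, finrank_euclideanSpace, Fintype.card_fin,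
      Nat.add_sub_cancel, ← lintegral_mul_const _ (by fun_prop)]
    refine lintegral_congr fun v ↦ ?_
    rw [hc, ← lintegral_const_mul _ (by fun_prop)]
    refine lintegral_congr fun s ↦ ?_
    have hs : ‖s.1 • v.1‖ = s.1 := by
      rw [norm_smul, norm_eq_of_mem_sphere v, mul_one, Real.norm_of_nonneg s.2.out.le]
    simp only [hF, hs, PiLp.smul_apply, smul_eq_mul, mul_div_cancel_left₀ _ s.2.out.ne']
  have hnorm (y : ℝ) (w : E n) :
      ‖(WithLp.toLp 2 (Fin.cons y w.ofLp) : E (n + 1))‖ = √(y ^ 2 + ‖w‖ ^ 2) := by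
    rw [EuclideanSpace.norm_eq, EuclideanSpace.norm_sq_eq, Fin.sum_univ_succ]
    simp
  have hR : ∫⁻ z, F z = ENNReal.ofReal (sphereArea (n - 1)) *
      ((∫⁻ φ in Ioo 0 π, ENNReal.ofReal (sin φ ^ (n - 1)) * g (cos φ)) * c) := by
    set G : ℝ → ℝ → ℝ≥0∞ := fun y ρ ↦ g (y / √(y ^ 2 + ρ ^ 2)) * h √(y ^ 2 + ρ ^ 2) with hG
    set H : ℝ × ℝ → ℝ≥0∞ := fun p ↦ (Ioi (0 : ℝ)).indicator
      (fun ρ ↦ ENNReal.ofReal (ρ ^ (n - 1)) * G p.1 ρ) p.2 with hH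
    have hHm : Measurable H := by
      have : H = (Prod.snd ⁻¹' Ioi (0 : ℝ)).indicator
          (fun p : ℝ × ℝ ↦ ENNReal.ofReal (p.2 ^ (n - 1)) * G p.1 p.2) := rfl
      rw [this]
      refine Measurable.indicator ?_ (measurable_snd measurableSet_Ioi)
      fun_prop
    have e1 : ∫⁻ z, F z = ENNReal.ofReal (sphereArea (n - 1)) * ∫⁻ p, H p := by
      rw [lintegral_euclidean_succ hFm, volume_eq_prod, lintegral_prod _ hHm.aemeasurable,
        ← lintegral_const_mul _ (hHm.lintegral_prod_right')]
      refine lintegral_congr fun y ↦ ?_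
      rw [hH]
      simp only
      rw [lintegral_indicator measurableSet_Ioi, ← toSphere_euclidean_univ hn]
      have := lintegral_fun_norm (volume : Measure (E n)) (f := G y) (by fun_prop)
      rw [finrank_euclideanSpace, Fintype.card_fin] at this
      rw [← this]
      refine lintegral_congr fun w ↦ ?_
      simp only [hF, hG, hnorm, Fin.cons_zero]
    rw [e1, ← lintegral_comp_polarCoord_symm]
    congr 1
    have hpm : Measurable fun p : ℝ × ℝ ↦ ENNReal.ofReal p.1 • H (polarCoord.symm p) := by
      have := continuous_polarCoord_symm.measurable
      simp only [smul_eq_mul]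
      fun_prop
    rw [polarCoord_target, volume_eq_prod, ← prod_restrict, lintegral_prod_symm _ hpm.aemeasurable,
      ← lintegral_mul_const _ (by fun_prop)]
    have hsub : Ioo 0 π ⊆ Ioo (-π) π := Ioo_subset_Ioo_left (by linarith [pi_pos])
    rw [← inter_eq_self_of_subset_left hsub, ← setLIntegral_indicator measurableSet_Ioo]
    refine setLIntegral_congr_fun measurableSet_Ioo fun φ hφ ↦ ?_
    by_cases h0 : φ ∈ Ioo 0 π
    · rw [indicator_of_mem h0, hc, lintegral_volumeIoiPow n hI,
        ← lintegral_const_mul _ (by fun_prop)]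
      refine setLIntegral_congr_fun measurableSet_Ioi fun s (hs : 0 < s) ↦ ?_
      have hsin := sin_pos_of_mem_Ioo h0
      have hsq : √((s * cos φ) ^ 2 + (s * sin φ) ^ 2) = s := by
        rw [← Real.sqrt_sq hs.le]
        congr 1
        rw [Real.sqrt_sq hs.le]
        linear_combination s ^ 2 * sin_sq_add_cos_sq φ
      simp only [hH, polarCoord_symm_apply, hG, smul_eq_mul]
      rw [indicator_of_mem (mem_Ioi.2 (mul_pos hs hsin)), hsq, mul_div_cancel_left₀ _ hs.ne',
        mul_pow, ENNReal.ofReal_mul (by positivity)]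
      obtain ⟨m, rfl⟩ := Nat.exists_eq_add_of_le' hn
      rw [Nat.add_sub_cancel, pow_succ, ENNReal.ofReal_mul (by positivity)]
      ring
    · rw [indicator_of_notMem h0]
      refine (setLIntegral_congr_fun measurableSet_Ioi fun s (hs : 0 < s) ↦ ?_).trans
        lintegral_zero
      have hφ0 : φ ≤ 0 := by
        by_contra! hcon
        exact h0 ⟨hcon, hφ.2⟩
      have hsin := sin_nonpos_of_nonpos_of_neg_pi_le hφ0 hφ.1.le
      simp only [hH, polarCoord_symm_apply]
      rw [indicator_of_notMem, smul_zero]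
      exact fun hcon ↦ absurd (mul_nonpos_of_nonneg_of_nonpos hs.le hsin) (not_le.2 hcon)
  rw [hL, ← mul_assoc] at hR
  exact (ENNReal.mul_left_inj hc0 hcT).1 hR

/-- The surface measure on the sphere is invariant under linear isometries. -/
theorem integral_toSphere_comp_linearIsometryEquiv {V : Type*} [NormedAddCommGroup V]
    [InnerProductSpace ℝ V] [FiniteDimensional ℝ V] [MeasurableSpace V] [BorelSpace V]
    (L : V ≃ₗᵢ[ℝ] V) {f : V → ℝ} (hf : Measurable f) :
    ∫ v : sphere (0 : V) 1, f (L v) ∂(volume : Measure V).toSphere =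
      ∫ v : sphere (0 : V) 1, f v ∂(volume : Measure V).toSphere := by
  set T : sphere (0 : V) 1 → sphere (0 : V) 1 :=
    fun v ↦ ⟨L v, by simp [L.norm_map]⟩ with hT
  have hTm : Measurable T := (L.continuous.measurable.comp measurable_subtype_coe).subtype_mk
  have hmap : (volume : Measure V).toSphere.map T = (volume : Measure V).toSphere := by
    ext s hs
    rw [Measure.map_apply hTm hs, toSphere_apply' _ (hTm hs), toSphere_apply' _ hs]
    congr 1
    rw [← (L.measurePreserving).measure_preimage_emb L.toHomeomorph.measurableEmbedding
      (Ioo (0 : ℝ) 1 • (Subtype.val '' s))]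
    congr 1
    ext z
    simp only [mem_preimage, mem_smul, mem_image, Subtype.exists, hT]
    constructor
    · rintro ⟨a, ha, _, ⟨w, hw, hws, rfl⟩, rfl⟩
      exact ⟨a, ha, L w, ⟨L w, by simpa using hw, hws, rfl⟩, by simp⟩
    · rintro ⟨a, ha, _, ⟨w, hw, hws, rfl⟩, hz⟩
      refine ⟨a, ha, L.symm w, ⟨L.symm w, by simpa using hw, by simpa using hws, rfl⟩, ?_⟩
      rw [← map_smul, hz, L.symm_apply_apply]
  conv_rhs => rw [← hmap]
  exact (integral_map hTm.aemeasurable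
    (hf.comp measurable_subtype_coe).aestronglyMeasurable).symm

theorem sq_le_one_of_mem_sphere {d : ℕ} (v : sphere (0 : E d) 1) (i : Fin d) : v.1 i ^ 2 ≤ 1 := by
  have := PiLp.norm_apply_le v.1 i
  rw [norm_eq_of_mem_sphere v, Real.norm_eq_abs] at this
  exact (sq_le_one_iff_abs_le_one _).2 this

theorem denominator_nonneg {x r t : ℝ} (hx : 0 ≤ x) (hr : 0 < r) (ht : t ^ 2 ≤ 1) :
    0 ≤ x ^ 2 + r ^ 2 + 2 * r * x * t := by
  have := abs_le.1 ((sq_le_one_iff_abs_le_one t).1 ht)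
  nlinarith [sq_nonneg (x - r), mul_nonneg hr.le hx]

/-- The transversal trace of the outer-product integral. -/
theorem integral_toSphere_transversal {n : ℕ} (hn : 1 ≤ n) {x r : ℝ} (hx : 0 ≤ x) (hr : 0 < r) :
    ∫ v : sphere (0 : E (n + 1)) 1,
        r ^ 2 * (1 - v.1 0 ^ 2) / (x ^ 2 + r ^ 2 + 2 * r * x * v.1 0)
      ∂(volume : Measure (E (n + 1))).toSphere =
      sphereArea (n - 1) * Jfun (n + 1) (x / r) := by
  set q : ℝ → ℝ := fun t ↦ r ^ 2 * (1 - t ^ 2) / (x ^ 2 + r ^ 2 + 2 * r * x * t) with hq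
  have hqm : Measurable q := by fun_prop
  have hq0 {t : ℝ} (ht : t ^ 2 ≤ 1) : 0 ≤ q t :=
    div_nonneg (mul_nonneg (sq_nonneg r) (sub_nonneg.2 ht)) (denominator_nonneg hx hr ht)
  change ∫ v : sphere (0 : E (n + 1)) 1, q (v.1 0) ∂_ = _
  rw [integral_eq_lintegral_of_nonneg_ae
      (Filter.Eventually.of_forall fun v ↦ hq0 (sq_le_one_of_mem_sphere v 0))
      (by fun_prop : Measurable fun v : sphere (0 : E (n + 1)) 1 ↦ q (v.1 0)).aestronglyMeasurable,
    lintegral_toSphere_zonal hn (g := fun t ↦ ENNReal.ofReal (q t)) (by fun_prop),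
    ENNReal.toReal_mul, ENNReal.toReal_ofReal (sphereArea_nonneg _)]
  congr 1
  have key {φ : ℝ} : sin φ ^ (n + 1) / (1 + (x / r) ^ 2 + 2 * (x / r) * cos φ) =
      sin φ ^ (n - 1) * q (cos φ) := by
    obtain ⟨m, rfl⟩ := Nat.exists_eq_add_of_le' hn
    have hD : 1 + (x / r) ^ 2 + 2 * (x / r) * cos φ =
        (x ^ 2 + r ^ 2 + 2 * r * x * cos φ) / r ^ 2 := by
      field_simp
      ring
    rw [hD, hq, Nat.add_sub_cancel]
    simp only
    rw [← sin_sq, div_div_eq_mul_div]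
    ring
  rw [Jfun, intervalIntegral.integral_of_le pi_nonneg, integral_Ioc_eq_integral_Ioo,
    integral_eq_lintegral_of_nonneg_ae]
  · congr 1
    refine setLIntegral_congr_fun measurableSet_Ioo fun φ hφ ↦ ?_
    rw [key, ENNReal.ofReal_mul (pow_nonneg (sin_pos_of_mem_Ioo hφ).le _)]
  · filter_upwards [ae_restrict_mem measurableSet_Ioo] with φ hφ
    rw [key]
    exact mul_nonneg (pow_nonneg (sin_pos_of_mem_Ioo hφ).le _) (hq0 (cos_sq_le_one φ))
  · exact (by fun_prop : Measurable fun φ : ℝ ↦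
      sin φ ^ (n + 1) / (1 + (x / r) ^ 2 + 2 * (x / r) * cos φ)).aestronglyMeasurable

theorem ae_toSphere_ne_neg_one {n : ℕ} (hn : 1 ≤ n) :
    ∀ᵐ v : sphere (0 : E (n + 1)) 1 ∂(volume : Measure (E (n + 1))).toSphere, v.1 0 ≠ -1 := by
  have hm : Measurable (({-1} : Set ℝ).indicator (1 : ℝ → ℝ≥0∞)) :=
    measurable_one.indicator (measurableSet_singleton _)
  have h := lintegral_toSphere_zonal hn hm
  rw [setLIntegral_congr_fun (g := 0) measurableSet_Ioo] at h
  · simp only [Pi.zero_apply, lintegral_zero, mul_zero] at h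
    rw [lintegral_eq_zero_iff (by fun_prop)] at h
    filter_upwards [h] with v hv hv1
    simp [hv1] at hv
  · intro φ hφ
    have : cos φ ≠ -1 := by
      intro hc
      have := sin_sq_add_cos_sq φ
      have := sin_pos_of_mem_Ioo hφ
      nlinarith
    simp [this]

section Entries

variable {n : ℕ} (x r : ℝ)

/-- The `(i, j)` entry of the normalized outer product. -/
def outerEntry (i j : Fin (n + 1)) (z : E (n + 1)) : ℝ :=
  (x * (Pi.single 0 1 : Fin (n + 1) → ℝ) i + r * z i) *
    (x * (Pi.single 0 1 : Fin (n + 1) → ℝ) j + r * z j) / (x ^ 2 + r ^ 2 + 2 * r * x * z 0)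

theorem measurable_outerEntry (i j : Fin (n + 1)) : Measurable (outerEntry x r i j) := by
  unfold outerEntry
  fun_prop

theorem sum_sq_of_mem_sphere (v : sphere (0 : E (n + 1)) 1) :
    v.1 0 ^ 2 + ∑ i : Fin n, v.1 i.succ ^ 2 = 1 := by
  rw [← Fin.sum_univ_succ (fun i ↦ v.1 i ^ 2), ← EuclideanSpace.real_norm_sq_eq,
    norm_eq_of_mem_sphere v, one_pow]

theorem outerEntry_zero_zero_add (v : sphere (0 : E (n + 1)) 1)
    (hD : x ^ 2 + r ^ 2 + 2 * r * x * v.1 0 ≠ 0) :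
    outerEntry x r 0 0 v.1 =
      1 - r ^ 2 * (1 - v.1 0 ^ 2) / (x ^ 2 + r ^ 2 + 2 * r * x * v.1 0) := by
  rw [outerEntry, Pi.single_eq_same, eq_sub_iff_add_eq, ← add_div, div_eq_one_iff_eq hD]
  ring

theorem sum_outerEntry_succ (v : sphere (0 : E (n + 1)) 1) :
    ∑ i : Fin n, outerEntry x r i.succ i.succ v.1 =
      r ^ 2 * (1 - v.1 0 ^ 2) / (x ^ 2 + r ^ 2 + 2 * r * x * v.1 0) := by
  rw [← eq_sub_of_add_eq' (sum_sq_of_mem_sphere v), Finset.mul_sum, Finset.sum_div]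
  refine Finset.sum_congr rfl fun i _ ↦ ?_
  rw [outerEntry, Pi.single_eq_of_ne (Fin.succ_ne_zero i)]
  ring

variable {x r}

theorem norm_sq_denominator (v : sphere (0 : E (n + 1)) 1) :
    ∑ i, (x * (Pi.single 0 1 : Fin (n + 1) → ℝ) i + r * v.1 i) ^ 2 =
      x ^ 2 + r ^ 2 + 2 * r * x * v.1 0 := by
  have h (i : Fin n) : (x * (Pi.single 0 1 : Fin (n + 1) → ℝ) i.succ + r * v.1 i.succ) ^ 2 =
      r ^ 2 * v.1 i.succ ^ 2 := by
    rw [Pi.single_eq_of_ne (Fin.succ_ne_zero i)]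
    ring
  rw [Fin.sum_univ_succ, Pi.single_eq_same, Finset.sum_congr rfl fun i _ ↦ h i, ← Finset.mul_sum]
  linear_combination r ^ 2 * sum_sq_of_mem_sphere v

theorem integrable_outerEntry (i j : Fin (n + 1)) :
    Integrable (fun v : sphere (0 : E (n + 1)) 1 ↦ outerEntry x r i j v.1)
      (volume : Measure (E (n + 1))).toSphere := by
  refine Integrable.of_bound
    ((measurable_outerEntry x r i j).comp measurable_subtype_coe).aestronglyMeasurable 1
    (Filter.Eventually.of_forall fun v ↦ ?_)
  set a : Fin (n + 1) → ℝ := fun i ↦ x * (Pi.single 0 1 : Fin (n + 1) → ℝ) i + r * v.1 i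
  have hle (k : Fin (n + 1)) : a k ^ 2 ≤ ∑ i, a i ^ 2 :=
    Finset.single_le_sum (f := fun i ↦ a i ^ 2) (fun _ _ ↦ sq_nonneg _) (Finset.mem_univ k)
  rw [outerEntry, ← norm_sq_denominator v, norm_div, Real.norm_eq_abs, Real.norm_eq_abs]
  change |a i * a j| / |∑ i, a i ^ 2| ≤ 1
  rw [abs_of_nonneg (Finset.sum_nonneg fun i _ ↦ sq_nonneg (a i))]
  refine div_le_one_of_le₀ ?_ (Finset.sum_nonneg fun i _ ↦ sq_nonneg (a i))
  rw [abs_mul]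
  nlinarith [hle i, hle j, sq_nonneg (|a i| - |a j|), sq_abs (a i), sq_abs (a j)]

theorem integral_outerEntry_of_ne_of_ne_zero {i j : Fin (n + 1)} (hij : i ≠ j) (hi : i ≠ 0) :
    ∫ v : sphere (0 : E (n + 1)) 1, outerEntry x r i j v.1
      ∂(volume : Measure (E (n + 1))).toSphere = 0 := by
  classical
  let L : E (n + 1) ≃ₗᵢ[ℝ] E (n + 1) := LinearIsometryEquiv.piLpCongrRight 2
    fun k ↦ if k = i then LinearIsometryEquiv.neg ℝ else LinearIsometryEquiv.refl ℝ ℝ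
  have hLi (z : E (n + 1)) : L z i = -z i := by simp [L]
  have hL {k : Fin (n + 1)} (hk : k ≠ i) (z : E (n + 1)) : L z k = z k := by simp [L, hk]
  have h := integral_toSphere_comp_linearIsometryEquiv L (measurable_outerEntry x r i j)
  have hneg (z : E (n + 1)) : outerEntry x r i j (L z) = -outerEntry x r i j z := by
    rw [outerEntry, outerEntry, hLi, hL hij.symm, hL hi.symm, Pi.single_eq_of_ne hi]
    ring
  simp only [hneg, integral_neg] at h
  linarith

theorem integral_outerEntry_of_ne {i j : Fin (n + 1)} (hij : i ≠ j) :
    ∫ v : sphere (0 : E (n + 1)) 1, outerEntry x r i j v.1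
      ∂(volume : Measure (E (n + 1))).toSphere = 0 := by
  by_cases hi : i = 0
  · rw [← integral_outerEntry_of_ne_of_ne_zero hij.symm (hi ▸ hij.symm)]
    refine integral_congr_ae (Filter.Eventually.of_forall fun v ↦ ?_)
    simp only [outerEntry]
    rw [mul_comm (x * _ + _)]
  · exact integral_outerEntry_of_ne_of_ne_zero hij hi

theorem integral_outerEntry_diag_eq {i j : Fin (n + 1)} (hi : i ≠ 0) (hj : j ≠ 0) :
    ∫ v : sphere (0 : E (n + 1)) 1, outerEntry x r i i v.1
      ∂(volume : Measure (E (n + 1))).toSphere =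
    ∫ v : sphere (0 : E (n + 1)) 1, outerEntry x r j j v.1
      ∂(volume : Measure (E (n + 1))).toSphere := by
  let L : E (n + 1) ≃ₗᵢ[ℝ] E (n + 1) :=
    LinearIsometryEquiv.piLpCongrLeft 2 ℝ ℝ (Equiv.swap i j)
  have hL (z : E (n + 1)) (k : Fin (n + 1)) : L z k = z (Equiv.swap i j k) := by
    simp [L, Equiv.piCongrLeft']
  rw [← integral_toSphere_comp_linearIsometryEquiv L (measurable_outerEntry x r j j)]
  refine integral_congr_ae (Filter.Eventually.of_forall fun v ↦ ?_)
  simp only [outerEntry, hL, Equiv.swap_apply_right, Pi.single_eq_of_ne hi, Pi.single_eq_of_ne hj,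
    Equiv.swap_apply_of_ne_of_ne hi.symm hj.symm]

theorem integral_outerEntry_diag (hn : 1 ≤ n) (hx : 0 ≤ x) (hr : 0 < r) {i : Fin (n + 1)}
    (hi : i ≠ 0) :
    ∫ v : sphere (0 : E (n + 1)) 1, outerEntry x r i i v.1
      ∂(volume : Measure (E (n + 1))).toSphere =
    sphereArea (n - 1) / n * Jfun (n + 1) (x / r) := by
  have hn0 : (n : ℝ) ≠ 0 := by exact_mod_cast (Nat.one_le_iff_ne_zero.1 hn)
  have h := integral_toSphere_transversal hn hx hr
  simp only [← sum_outerEntry_succ] at h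
  rw [integral_finsetSum _ fun k _ ↦ integrable_outerEntry k.succ k.succ,
    Finset.sum_congr rfl fun k _ ↦ integral_outerEntry_diag_eq (Fin.succ_ne_zero k) hi,
    Finset.sum_const, Finset.card_univ, Fintype.card_fin, nsmul_eq_mul] at h
  rw [div_mul_eq_mul_div, eq_div_iff hn0, mul_comm, h]

theorem denominator_ne_zero {t : ℝ} (hx : 0 ≤ x) (hr : 0 < r) (ht : t ^ 2 ≤ 1) (ht1 : t ≠ -1) :
    x ^ 2 + r ^ 2 + 2 * r * x * t ≠ 0 := by
  have hlt : -1 < t := lt_of_le_of_ne (abs_le.1 ((sq_le_one_iff_abs_le_one t).1 ht)).1 ht1.symm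
  rcases hx.eq_or_lt with rfl | hx
  · simp [hr.ne']
  · have := mul_pos (mul_pos hr hx) (neg_lt_iff_pos_add'.1 hlt)
    nlinarith [sq_nonneg (x - r)]

theorem integral_outerEntry_zero_zero (hn : 1 ≤ n) (hx : 0 ≤ x) (hr : 0 < r) :
    ∫ v : sphere (0 : E (n + 1)) 1, outerEntry x r 0 0 v.1
      ∂(volume : Measure (E (n + 1))).toSphere =
    sphereArea n - sphereArea (n - 1) * Jfun (n + 1) (x / r) := by
  have hint : Integrable (fun v : sphere (0 : E (n + 1)) 1 ↦
      r ^ 2 * (1 - v.1 0 ^ 2) / (x ^ 2 + r ^ 2 + 2 * r * x * v.1 0))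
      (volume : Measure (E (n + 1))).toSphere := by
    simp only [← sum_outerEntry_succ]
    exact integrable_finsetSum _ fun k _ ↦ integrable_outerEntry k.succ k.succ
  have hae : (fun v : sphere (0 : E (n + 1)) 1 ↦ outerEntry x r 0 0 v.1)
      =ᵐ[(volume : Measure (E (n + 1))).toSphere] fun v ↦
        1 - r ^ 2 * (1 - v.1 0 ^ 2) / (x ^ 2 + r ^ 2 + 2 * r * x * v.1 0) := by
    filter_upwards [ae_toSphere_ne_neg_one hn] with v hv
    exact outerEntry_zero_zero_add x r v
      (denominator_ne_zero hx hr (sq_le_one_of_mem_sphere v 0) hv)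
  rw [integral_congr_ae hae, integral_sub (integrable_const _) hint,
    integral_toSphere_transversal hn hx hr, integral_const, smul_eq_mul, mul_one, measureReal_def,
    toSphere_euclidean_univ (Nat.le_add_left 1 n), Nat.add_sub_cancel,
    ENNReal.toReal_ofReal (sphereArea_nonneg n)]

end Entries

/-- spherical outer-product integral.
For `d ≥ 2`, `x ≥ 0`, `r > 0`, with `σ` the surface measure on the unit sphere
`S^{d−1} ⊂ ℝ^d` and `e₁` the first standard basis vector,
`∫_{S^{d−1}} (xe₁+rv)(xe₁+rv)ᵀ/(x²+r²+2rx⟨v,e₁⟩) dσ(v)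
 = (S_{d−1} − S_{d−2} J(x/r)) e₁e₁ᵀ + (S_{d−2}/(d−1)) J(x/r) (I_d − e₁e₁ᵀ)`
(stated entrywise). -/
theorem statement16 {d : ℕ} (hd : 2 ≤ d) (x r : ℝ) (hx : 0 ≤ x) (hr : 0 < r) :
    ∀ i j : Fin d,
      (∫ v : Metric.sphere (0 : E d) 1,
          ((x • (EuclideanSpace.single (⟨0, by omega⟩ : Fin d) (1:ℝ)) + r • (v : E d)) i *
            (x • (EuclideanSpace.single (⟨0, by omega⟩ : Fin d) (1:ℝ)) + r • (v : E d)) j) /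
          (x^2 + r^2 +
            2*r*x*⟪(v : E d), EuclideanSpace.single (⟨0, by omega⟩ : Fin d) (1:ℝ)⟫)
          ∂((volume : Measure (E d)).toSphere)) =
        (sphereArea (d-1) - sphereArea (d-2) * Jfun d (x/r)) *
            Matrix.vecMulVec (EuclideanSpace.single (⟨0, by omega⟩ : Fin d) (1:ℝ))
              (EuclideanSpace.single (⟨0, by omega⟩ : Fin d) (1:ℝ)) i j +
          (sphereArea (d-2) / ((d : ℝ) - 1)) * Jfun d (x/r) *
            ((1 : Matrix (Fin d) (Fin d) ℝ) -
              Matrix.vecMulVec (EuclideanSpace.single (⟨0, by omega⟩ : Fin d) (1:ℝ))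
                (EuclideanSpace.single (⟨0, by omega⟩ : Fin d) (1:ℝ))) i j := by
  obtain ⟨n, rfl⟩ := Nat.exists_eq_add_of_le' (one_le_two.trans hd)
  have hn : 1 ≤ n := by omega
  intro i j
  have h0 : (⟨0, by omega⟩ : Fin (n + 1)) = 0 := rfl
  have hI (v : sphere (0 : E (n + 1)) 1) :
      ((x • (EuclideanSpace.single (0 : Fin (n + 1)) (1:ℝ)) + r • (v : E (n + 1))) i *
        (x • (EuclideanSpace.single (0 : Fin (n + 1)) (1:ℝ)) + r • (v : E (n + 1))) j) /
          (x^2 + r^2 +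
            2*r*x*⟪(v : E (n + 1)), EuclideanSpace.single (0 : Fin (n + 1)) (1:ℝ)⟫) =
        outerEntry x r i j v.1 := by
    rw [EuclideanSpace.inner_single_right]
    simp [outerEntry, Pi.single_apply]
  simp only [h0, hI, Nat.add_sub_cancel, Nat.cast_add, Nat.cast_one, add_sub_cancel_right,
    show n + 1 - 2 = n - 1 by omega, Matrix.sub_apply, Matrix.vecMulVec_apply,
    PiLp.single_apply]
  by_cases hij : i = j
  · subst hij
    by_cases hi : i = 0
    · subst hi
      simp [integral_outerEntry_zero_zero hn hx hr]
    · simp [hi, integral_outerEntry_diag hn hx hr hi]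
  · rw [integral_outerEntry_of_ne hij, Matrix.one_apply_ne hij]
    by_cases hi : i = 0
    · simp [show j ≠ 0 from fun h ↦ hij (hi.trans h.symm)]
    · simp [hi]
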